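/- (Finite-field Kummer summation.) Assume the characteristic p of κ is odd. Then for all multiplicative characters α, β of κ: F(α², β; α²β̄; −1) = ∑_{α' : α'² = α²} [g°(α²β̄)·g(α')] / [g(α²)·g°(α'β̄)], where the sum runs over the two multiplicative characters α' of κ satisfying α'² = α². -/

import Mathlib

/-!
Finite-field hypergeometric functions (Otsubo), basic definitions:
`κ` is a finite field with `q = Fintype.card κ` elements, `ψ` a fixed nontrivial
additive character, multiplicative characters are `MulChar κ ℂ` (extended by `0`
on `0`, with trivial character `1`).
-/

open scoped Classical

noncomputable section

variable {κ : Type*} [Field κ] [Fintype κ]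

instance : Fintype (MulChar κ ℂ) := Fintype.ofFinite _

/-- The Gauss sum `g(φ) = -∑_{x ∈ κ} ψ(x) φ(x)`. -/
def gS (ψ : AddChar κ ℂ) (φ : MulChar κ ℂ) : ℂ := -∑ x : κ, ψ x * φ x

/-- The variant `g°(φ) = q^{δ(φ)} · g(φ)`, where `δ(φ) = 1` iff `φ` is trivial. -/
def gSo (ψ : AddChar κ ℂ) (φ : MulChar κ ℂ) : ℂ :=
  (if φ = 1 then (Fintype.card κ : ℂ) else 1) * gS ψ φ

/-- The Pochhammer symbol `(α)_ν = g(αν)/g(α)`. -/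
def poch (ψ : AddChar κ ℂ) (α ν : MulChar κ ℂ) : ℂ := gS ψ (α * ν) / gS ψ α

/-- The variant Pochhammer symbol `(α)°_ν = g°(αν)/g°(α)`. -/
def pocho (ψ : AddChar κ ℂ) (α ν : MulChar κ ℂ) : ℂ := gSo ψ (α * ν) / gSo ψ α

/-- The finite hypergeometric function
`F(α₁,…,α_r; β₁,…,β_s; λ) = (1/(1-q)) ∑_ν ((α₁)_ν ⋯ (α_r)_ν / ((ε)°_ν (β₁)°_ν ⋯ (β_s)°_ν)) ν(λ)`
(the trivial character `ε = 1` appears implicitly among the lower parameters). -/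
def Fh (ψ : AddChar κ ℂ) {r s : ℕ} (A : Fin r → MulChar κ ℂ) (B : Fin s → MulChar κ ℂ)
    (l : κ) : ℂ :=
  (1 - (Fintype.card κ : ℂ))⁻¹ *
    ∑ ν : MulChar κ ℂ,
      ((∏ i, poch ψ (A i) ν) / (pocho ψ 1 ν * ∏ j, pocho ψ (B j) ν)) * ν l

lemma MulChar.apply_neg_one_mul_self {F : Type*} [Field F] (φ : MulChar F ℂ) :
    φ (-1) * φ (-1) = 1 := by
  rw [← map_mul, neg_one_mul, neg_neg, map_one]

lemma gS_eq_neg_gaussSum (ψ : AddChar κ ℂ) (φ : MulChar κ ℂ) : gS ψ φ = -gaussSum φ ψ := by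
  simp only [gS, gaussSum, mul_comm]

lemma cast_card_ne_zero : (Fintype.card κ : ℂ) ≠ 0 :=
  Nat.cast_ne_zero.mpr Fintype.card_ne_zero

lemma one_sub_cast_card_ne_zero : (1 - (Fintype.card κ : ℂ)) ≠ 0 := by
  rw [sub_ne_zero, Ne, eq_comm, Nat.cast_eq_one]
  exact Fintype.one_lt_card.ne'

lemma gS_mul_gSo_inv {ψ : AddChar κ ℂ} (hψ : ψ ≠ 1) (φ : MulChar κ ℂ) :
    gS ψ φ⁻¹ * gSo ψ φ = φ (-1) * Fintype.card κ := by
  rcases eq_or_ne φ 1 with rfl | hφ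
  · simp [gSo, gS_eq_neg_gaussSum, gaussSum_one_left hψ, MulChar.one_apply]
  · have hcard := gaussSum_mul_gaussSum_eq_card hφ (AddChar.IsPrimitive.of_ne_one hψ)
    have hshift := gaussSum_mulShift_eq φ⁻¹ ψ (-1)
    rw [Units.val_neg, Units.val_one, ← AddChar.inv_mulShift, inv_inv] at hshift
    have hsq : φ (-1) * φ (-1) = 1 := φ.apply_neg_one_mul_self
    simp only [gSo, if_neg hφ, one_mul, gS_eq_neg_gaussSum]
    rw [hshift] at hcard
    linear_combination φ (-1) * hcard - gaussSum φ ψ * gaussSum φ⁻¹ ψ * hsq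

lemma gS_ne_zero {ψ : AddChar κ ℂ} (hψ : ψ ≠ 1) (φ : MulChar κ ℂ) : gS ψ φ ≠ 0 := by
  have h := gS_mul_gSo_inv hψ φ⁻¹
  rw [inv_inv] at h
  have hne := left_ne_zero_of_mul_eq_one φ⁻¹.apply_neg_one_mul_self
  exact left_ne_zero_of_mul (h ▸ mul_ne_zero hne cast_card_ne_zero)

lemma inv_gSo {ψ : AddChar κ ℂ} (hψ : ψ ≠ 1) (φ : MulChar κ ℂ) :
    (gSo ψ φ)⁻¹ = φ (-1) * gS ψ φ⁻¹ / Fintype.card κ := by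
  have h := gS_mul_gSo_inv hψ φ
  have hsq : φ (-1) * φ (-1) = 1 := φ.apply_neg_one_mul_self
  have hq := cast_card_ne_zero (κ := κ)
  refine inv_eq_of_mul_eq_one_left ?_
  field_simp
  linear_combination φ (-1) * h + (Fintype.card κ : ℂ) * hsq

lemma gaussSum_mul_gaussSum_eq_sum_mulShift (ψ : AddChar κ ℂ) (φ θ : MulChar κ ℂ) :
    gaussSum φ ψ * gaussSum θ ψ =
      ∑ t : κ, φ t * gaussSum (φ * θ) (ψ.mulShift (1 + t)) := by
  simp only [gaussSum, Finset.mul_sum]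
  rw [Finset.sum_comm]
  refine Finset.sum_congr rfl fun y _ ↦ ?_
  rcases eq_or_ne y 0 with rfl | hy
  · simp [MulChar.map_zero]
  · rw [← Equiv.sum_comp (Equiv.mulRight₀ y hy), Finset.sum_mul]
    refine Finset.sum_congr rfl fun t _ ↦ ?_
    simp only [Equiv.mulRight₀_apply, AddChar.mulShift_apply, MulChar.mul_apply, map_mul,
      add_mul, one_mul, AddChar.map_add_eq_mul]
    ring

lemma gS_mul_gS (ψ : AddChar κ ℂ) (φ θ : MulChar κ ℂ) :
    gS ψ φ * gS ψ θ = ∑ t : κ, φ t * gaussSum (φ * θ) (ψ.mulShift (1 + t)) := by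
  rw [gS_eq_neg_gaussSum, gS_eq_neg_gaussSum, neg_mul_neg,
    gaussSum_mul_gaussSum_eq_sum_mulShift]

lemma gaussSum_mulShift_mul_gaussSum_mulShift (β : MulChar κ ℂ) (ψ : AddChar κ ℂ) {a b : κ}
    (ha : a ≠ 0) :
    gaussSum β (ψ.mulShift a) * gaussSum β (ψ.mulShift b) =
      gaussSum β ψ * gaussSum β (ψ.mulShift (a * b)) := by
  have h (φ : AddChar κ ℂ) := gaussSum_mulShift_eq β φ (Units.mk0 a ha)
  simp only [Units.val_mk0] at h
  have hab : ψ.mulShift (a * b) = (ψ.mulShift b).mulShift a := by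
    rw [AddChar.mulShift_mulShift, mul_comm]
  rw [hab, h, h]
  ring

lemma gaussSum_mulShift_one_add_mul_one_sub (hp : ringChar κ ≠ 2) (β : MulChar κ ℂ)
    (ψ : AddChar κ ℂ) (t : κ) :
    gaussSum β (ψ.mulShift (1 + t)) * gaussSum β (ψ.mulShift (1 - t)) =
      gaussSum β ψ * gaussSum β (ψ.mulShift (1 - t ^ 2)) := by
  rw [show (1 : κ) - t ^ 2 = (1 + t) * (1 - t) by ring]
  by_cases h : 1 + t = 0
  · have h' : 1 - t ≠ 0 := fun h' ↦
      Ring.two_ne_zero hp (by linear_combination h + h')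
    rw [mul_comm, gaussSum_mulShift_mul_gaussSum_mulShift β ψ h', mul_comm (1 - t)]
  · exact gaussSum_mulShift_mul_gaussSum_mulShift β ψ h

lemma MulChar.sum_apply_eq_ite (a : κ) :
    ∑ ν : MulChar κ ℂ, ν a = if a = 1 then (Fintype.card κ : ℂ) - 1 else 0 := by
  split_ifs with ha
  · have hcard : Fintype.card (MulChar κ ℂ) + 1 = Fintype.card κ := by
      rw [← Nat.card_eq_fintype_card, MulChar.card_eq_card_units_of_hasEnoughRootsOfUnity,
        Nat.card_eq_fintype_card, Fintype.card_eq_card_units_add_one κ]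
    rw [← hcard]
    simp [ha]
  · obtain ⟨χ, hχ⟩ := MulChar.exists_apply_ne_one_of_hasEnoughRootsOfUnity κ ℂ ha
    refine eq_zero_of_mul_eq_self_left hχ ?_
    simp only [Finset.mul_sum, ← MulChar.mul_apply]
    exact Fintype.sum_bijective _ (Group.mulLeft_bijective χ) _ _ fun _ ↦ rfl

lemma MulChar.sum_eq_ite (χ : MulChar κ ℂ) :
    ∑ a, χ a = if χ = 1 then (Fintype.card κ : ℂ) - 1 else 0 := by
  split_ifs with h
  · rw [h, MulChar.sum_one_eq_card_units, Fintype.card_eq_card_units_add_one κ]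
    simp
  · exact MulChar.sum_eq_zero_of_ne_one h

lemma MulChar.sum_sq_eq_apply (χ : MulChar κ ℂ) (s : κ) :
    ∑ φ ∈ Finset.univ.filter (fun φ : MulChar κ ℂ => φ ^ 2 = χ), φ s =
      ∑ t ∈ Finset.univ.filter (fun t : κ => t ^ 2 = s), χ t := by
  have hq : (Fintype.card κ : ℂ) - 1 ≠ 0 := by
    rw [← neg_sub]; exact neg_ne_zero.mpr one_sub_cast_card_ne_zero
  refine mul_left_cancel₀ hq ?_
  calc ((Fintype.card κ : ℂ) - 1) *
        ∑ φ ∈ Finset.univ.filter (fun φ : MulChar κ ℂ => φ ^ 2 = χ), φ s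
      = ∑ φ : MulChar κ ℂ, φ s * ∑ t, (φ⁻¹ ^ 2 * χ) t := by
        rw [Finset.sum_filter, Finset.mul_sum]
        refine Finset.sum_congr rfl fun φ _ ↦ ?_
        rw [MulChar.sum_eq_ite]
        have : φ⁻¹ ^ 2 * χ = 1 ↔ φ ^ 2 = χ := by rw [inv_pow, inv_mul_eq_one]
        simp only [this]
        split_ifs <;> ring
    _ = ∑ t, χ t * ∑ φ : MulChar κ ℂ, φ (s * t⁻¹ ^ 2) := by
        simp only [Finset.mul_sum]
        rw [Finset.sum_comm]
        refine Finset.sum_congr rfl fun t _ ↦ Finset.sum_congr rfl fun φ _ ↦ ?_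
        simp only [pow_two, MulChar.mul_apply, MulChar.inv_apply', map_mul]
        ring
    _ = _ := by
        rw [Finset.sum_filter, Finset.mul_sum]
        refine Finset.sum_congr rfl fun t _ ↦ ?_
        rcases eq_or_ne t 0 with rfl | ht
        · simp
        · have : s * t⁻¹ ^ 2 = 1 ↔ t ^ 2 = s := by
            rw [inv_pow, mul_inv_eq_one₀ (pow_ne_zero 2 ht), eq_comm]
          rw [MulChar.sum_apply_eq_ite]
          simp only [this]
          split_ifs <;> ring

lemma MulChar.sum_sq_eq_sum_mul (χ : MulChar κ ℂ) (f : κ → ℂ) :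
    ∑ φ ∈ Finset.univ.filter (fun φ : MulChar κ ℂ => φ ^ 2 = χ), ∑ s, φ s * f s =
      ∑ t, χ t * f (t ^ 2) := by
  rw [Finset.sum_comm]
  simp only [← Finset.sum_mul, MulChar.sum_sq_eq_apply]
  rw [← Finset.sum_fiberwise (s := Finset.univ) (g := fun t : κ ↦ t ^ 2)
    (f := fun t ↦ χ t * f (t ^ 2))]
  refine Finset.sum_congr rfl fun s _ ↦ ?_
  rw [Finset.sum_mul]
  refine Finset.sum_congr rfl fun t ht ↦ ?_
  rw [(Finset.mem_filter.mp ht).2]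

lemma sum_gS_mul_gS_mul_gS_mul_gS (ψ : AddChar κ ℂ) (α β : MulChar κ ℂ) :
    ∑ ν : MulChar κ ℂ,
        ν (-1) * (gS ψ (α * ν) * gS ψ (α * β⁻¹ * ν)⁻¹) * (gS ψ ν⁻¹ * gS ψ (β * ν)) =
      ((Fintype.card κ : ℂ) - 1) * ∑ t, α t *
        (gaussSum β (ψ.mulShift (1 + t)) * gaussSum β (ψ.mulShift (1 - t))) := by
  have h₁ (ν : MulChar κ ℂ) : α * ν * (α * β⁻¹ * ν)⁻¹ = β := by
    rw [mul_inv_eq_iff_eq_mul, ← mul_assoc, mul_comm β, inv_mul_cancel_right]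
  have h₂ (ν : MulChar κ ℂ) : ν⁻¹ * (β * ν) = β := by rw [mul_comm β, inv_mul_cancel_left]
  simp only [gS_mul_gS, h₁, h₂]
  calc _ = ∑ t, ∑ s, α t * gaussSum β (ψ.mulShift (1 + t)) * gaussSum β (ψ.mulShift (1 + s)) *
        ∑ ν : MulChar κ ℂ, ν (-1 * t * s⁻¹) := by
        simp only [mul_assoc, Finset.sum_mul_sum]
        simp only [Finset.mul_sum]
        rw [Finset.sum_comm]
        refine Finset.sum_congr rfl fun t _ ↦ ?_
        rw [Finset.sum_comm]
        refine Finset.sum_congr rfl fun s _ ↦ Finset.sum_congr rfl fun ν _ ↦ ?_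
        simp only [MulChar.mul_apply, MulChar.inv_apply', map_mul]
        ring
    _ = _ := by
        rw [Finset.mul_sum]
        refine Finset.sum_congr rfl fun t _ ↦ ?_
        rcases eq_or_ne t 0 with rfl | ht
        · simp [MulChar.map_zero]
        · have h (s : κ) : -1 * t * s⁻¹ = 1 ↔ s = -t := by
            rcases eq_or_ne s 0 with rfl | hs
            · simp [ht, eq_comm]
            · rw [mul_inv_eq_one₀ hs, neg_one_mul, eq_comm]
          simp only [MulChar.sum_apply_eq_ite, h, mul_ite, mul_zero, Finset.sum_ite_eq',
            Finset.mem_univ, if_true]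
          rw [← sub_eq_add_neg]
          ring

/-- finite-field Kummer summation: in odd characteristic,
`F(α²,β;α²β̄;-1) = ∑_{α'² = α²} g°(α²β̄)g(α')/(g(α²)g°(α'β̄))`. -/
theorem stmt_13 (hp : ringChar κ ≠ 2) (ψ : AddChar κ ℂ) (hψ : ψ ≠ 1)
    (α β : MulChar κ ℂ) :
    Fh ψ ![α ^ 2, β] ![α ^ 2 * β⁻¹] (-1) =
      ∑ α' ∈ Finset.univ.filter (fun α' : MulChar κ ℂ => α' ^ 2 = α ^ 2),
        gSo ψ (α ^ 2 * β⁻¹) * gS ψ α' / (gS ψ (α ^ 2) * gSo ψ (α' * β⁻¹)) := by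
  have hq := cast_card_ne_zero (κ := κ)
  have hq₁ := one_sub_cast_card_ne_zero (κ := κ)
  have hα := gS_ne_zero hψ (α ^ 2)
  have hβ := gS_ne_zero hψ β
  have hβ_inv : β⁻¹ (-1) = β (-1) := by rw [MulChar.inv_apply', inv_neg, inv_one]
  have hα_sq : (α ^ 2) (-1) = 1 := by rw [pow_two, MulChar.mul_apply, ← map_mul]; simp
  have hone : gSo ψ (1 : MulChar κ ℂ) = Fintype.card κ := by
    simp [gSo, gS_eq_neg_gaussSum, gaussSum_one_left hψ]
  set C : ℂ := gSo ψ (α ^ 2 * β⁻¹) / gS ψ (α ^ 2) * β (-1) / Fintype.card κ with hC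
  have lhs : Fh ψ ![α ^ 2, β] ![α ^ 2 * β⁻¹] (-1) =
      (1 - (Fintype.card κ : ℂ))⁻¹ * (C / gS ψ β * ∑ ν : MulChar κ ℂ, ν (-1) *
        (gS ψ (α ^ 2 * ν) * gS ψ (α ^ 2 * β⁻¹ * ν)⁻¹) * (gS ψ ν⁻¹ * gS ψ (β * ν))) := by
    rw [Fh]
    congr 1
    rw [Finset.mul_sum]
    refine Finset.sum_congr rfl fun ν _ ↦ ?_
    have hν_sq : ν (-1) * ν (-1) = 1 := ν.apply_neg_one_mul_self
    simp only [poch, pocho, Fin.prod_univ_two, Fin.prod_univ_one, Matrix.cons_val_zero,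
      Matrix.cons_val_one, one_mul, hone, div_eq_mul_inv, mul_inv, inv_inv, hC]
    rw [inv_gSo hψ ν, inv_gSo hψ (α ^ 2 * β⁻¹ * ν), MulChar.mul_apply, MulChar.mul_apply, hα_sq,
      hβ_inv, mul_inv, mul_inv, inv_inv]
    generalize gS ψ ((α ^ 2)⁻¹ * β * ν⁻¹) = w
    field_simp
    linear_combination gS ψ (α ^ 2 * ν) * gS ψ (β * ν) * ν (-1) * gS ψ ν⁻¹ * β (-1) * w *
      gSo ψ (α ^ 2 * β⁻¹) * hν_sq
  have rhs (α' : MulChar κ ℂ) :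
      gSo ψ (α ^ 2 * β⁻¹) * gS ψ α' / (gS ψ (α ^ 2) * gSo ψ (α' * β⁻¹)) =
        C * ∑ s, α' s * gaussSum β (ψ.mulShift (1 - s)) := by
    have h : gS ψ α' * gS ψ (α' * β⁻¹)⁻¹ =
        α' (-1) * ∑ s, α' s * gaussSum β (ψ.mulShift (1 - s)) := by
      rw [gS_mul_gS, mul_inv_rev, inv_inv, mul_comm β, mul_inv_cancel_left,
        ← Equiv.sum_comp (Equiv.neg κ), Finset.mul_sum]
      refine Finset.sum_congr rfl fun s _ ↦ ?_
      rw [Equiv.neg_apply, ← sub_eq_add_neg, ← neg_one_mul s, map_mul, mul_assoc]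
    have hsq : α' (-1) * α' (-1) = 1 := α'.apply_neg_one_mul_self
    rw [div_eq_mul_inv, mul_inv, inv_gSo hψ, MulChar.mul_apply, hβ_inv, hC]
    generalize gS ψ (α' * β⁻¹)⁻¹ = w at h ⊢
    generalize ∑ s, α' s * gaussSum β (ψ.mulShift (1 - s)) = S at h ⊢
    field_simp
    linear_combination gSo ψ (α ^ 2 * β⁻¹) * β (-1) * (α' (-1) * h + S * hsq)
  rw [lhs, sum_gS_mul_gS_mul_gS_mul_gS, Finset.sum_congr rfl fun α' _ ↦ rhs α',
    ← Finset.mul_sum,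
    MulChar.sum_sq_eq_sum_mul (α ^ 2) fun s ↦ gaussSum β (ψ.mulShift (1 - s))]
  simp only [gaussSum_mulShift_one_add_mul_one_sub hp, mul_left_comm _ (gaussSum β ψ),
    ← Finset.mul_sum]
  rw [gS_eq_neg_gaussSum] at hβ ⊢
  have hβ' := neg_ne_zero.mp hβ
  field_simp
  ring

end
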